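/- arXiv:1911.10992 — 5 statements merged into one kernel-verified Lean document; each statement's English description precedes it below -/
import Mathlib

section
/- Let (L, α) be a 3-Hom-Lie-Rinehart algebra over (A, φ) and let (M, β) be a left module over (L, α) with action ψ, where M carries the trivial (abelian) 3-Hom-Lie A-algebra structure. Then (A, L ⊕ M, [·,·,·]', φ, α ⊕ β, ρ_{L⊕M}) is a 3-Hom-Lie-Rinehart algebra over (A, φ), where (α ⊕ β)(x₁ + m₁) := α(x₁) + β(m₁), [x₁ + m₁, x₂ + m₂, x₃ + m₃]' := [x₁, x₂, x₃] + ψ(x₁, x₂)m₃ + ψ(x₂, x₃)m₁ + ψ(x₃, x₁)m₂, and ρ_{L⊕M}(x₁ + m₁, x₂ + m₂) := ρ(x₁, x₂), for x₁, x₂, x₃ ∈ L, m₁, m₂, m₃ ∈ M. -/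
section Core

variable {R A L M : Type*} [CommRing R] [CommRing A] [Algebra R A]

/-- An `R`-linear map `δ : A → A` is a `φ`-derivation of `A`. -/
def IsPhiDerivation (φ : A → A) (δ : A →ₗ[R] A) : Prop :=
  ∀ a b : A, δ (a * b) = φ a * δ b + φ b * δ a

variable [AddCommGroup L] [Module R L] [AddCommGroup M] [Module R M]

/-- `(L, br, α)` is a 3-Hom-Lie algebra over `R`. -/
structure Is3HomLie (br : L →ₗ[R] L →ₗ[R] L →ₗ[R] L) (α : L →ₗ[R] L) : Prop where
  skew₁₂ : ∀ x y z, br x y z = - br y x z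
  skew₂₃ : ∀ x y z, br x y z = - br x z y
  jacobi : ∀ x y u v w, br (α x) (α y) (br u v w) =
    br (br x y u) (α v) (α w) + br (α u) (br x y v) (α w) + br (α u) (α v) (br x y w)

/-- `(ψ, β)` is a representation of the 3-Hom-Lie algebra `(L, br, α)` on `(M, β)`. -/
structure IsRep (br : L →ₗ[R] L →ₗ[R] L →ₗ[R] L) (α : L →ₗ[R] L)
    (ψ : L →ₗ[R] L →ₗ[R] M →ₗ[R] M) (β : M →ₗ[R] M) : Prop where
  skew : ∀ x y, ψ x y = - ψ y x
  comm_beta : ∀ x y m, ψ (α x) (α y) (β m) = β (ψ x y m)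
  rep₁ : ∀ x₁ x₂ x₃ x₄ m, ψ (α x₃) (α x₄) (ψ x₁ x₂ m) =
    ψ (α x₁) (α x₂) (ψ x₃ x₄ m) - ψ (br x₁ x₂ x₃) (α x₄) (β m) - ψ (α x₃) (br x₁ x₂ x₄) (β m)
  rep₂ : ∀ x₁ x₂ x₃ x₄ m, ψ (br x₁ x₂ x₃) (α x₄) (β m) =
    ψ (α x₁) (α x₂) (ψ x₃ x₄ m) + ψ (α x₂) (α x₃) (ψ x₁ x₄ m) + ψ (α x₃) (α x₁) (ψ x₂ x₄ m)

variable [Module A L] [IsScalarTower R A L]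

/-- `(A, L, br, φ, α, ρ)` is a 3-Hom-Lie-Rinehart algebra over `(A, φ)`. -/
structure Is3HomLR (φ : A →ₐ[R] A) (br : L →ₗ[R] L →ₗ[R] L →ₗ[R] L) (α : L →ₗ[R] L)
    (ρ : L →ₗ[R] L →ₗ[R] A →ₗ[R] A) : Prop where
  toIs3HomLie : Is3HomLie br α
  alpha_br : ∀ x y z, α (br x y z) = br (α x) (α y) (α z)
  alpha_smul : ∀ (a : A) (x : L), α (a • x) = φ a • α x
  rho_der : ∀ x y, IsPhiDerivation (⇑φ) (ρ x y)
  rep : IsRep br α ρ φ.toLinearMap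
  rho_smul_left : ∀ (a : A) (x y : L), ρ (a • x) y = ρ x (a • y)
  rho_smul : ∀ (a : A) (x y : L) (b : A), ρ (a • x) y b = φ (φ a) * ρ x y b
  br_smul : ∀ (x y : L) (a : A) (z : L),
    br x y (a • z) = φ (φ a) • br x y z + ρ x y a • α (α z)

variable [Module A M] [IsScalarTower R A M]

/-- `(M, β)` together with the action `ψ` is a left module over the
3-Hom-Lie-Rinehart algebra `(L, br, α)`. -/
structure IsLeftModule (φ : A →ₐ[R] A) (br : L →ₗ[R] L →ₗ[R] L →ₗ[R] L) (α : L →ₗ[R] L)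
    (ρ : L →ₗ[R] L →ₗ[R] A →ₗ[R] A) (β : M →ₗ[R] M)
    (ψ : L →ₗ[R] L →ₗ[R] M →ₗ[R] M) : Prop where
  rep : IsRep br α ψ β
  beta_smul : ∀ (a : A) (m : M), β (a • m) = φ a • β m
  psi_smul_left : ∀ (a : A) (x y : L), ψ (a • x) y = ψ x (a • y)
  psi_smul : ∀ (a : A) (x y : L) (m : M), ψ (a • x) y m = φ (φ a) • ψ x y m
  psi_leibniz : ∀ (x y : L) (a : A) (m : M),
    ψ x y (a • m) = φ (φ a) • ψ x y m + ρ x y a • β (β m)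

end Core

/-- If `(M, β)` with action `ψ` is a left module over the
3-Hom-Lie-Rinehart algebra `(L, α)` over `(A, φ)` (with `M` an abelian 3-Hom-Lie
`A`-algebra), then the semidirect sum `L ⊕ M` with
`[x₁+m₁, x₂+m₂, x₃+m₃] = [x₁,x₂,x₃] + ψ(x₁,x₂)m₃ + ψ(x₂,x₃)m₁ + ψ(x₃,x₁)m₂`,
`(α ⊕ β)(x+m) = α x + β m` and `ρ_{L⊕M}(x₁+m₁, x₂+m₂) = ρ(x₁,x₂)` is a
3-Hom-Lie-Rinehart algebra over `(A, φ)`. -/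
theorem semidirect_sum_threeHomLieRinehart_of_leftModule
    {R A L M : Type*} [CommRing R] [CommRing A] [Algebra R A]
    [AddCommGroup L] [Module R L] [Module A L] [IsScalarTower R A L]
    [AddCommGroup M] [Module R M] [Module A M] [IsScalarTower R A M]
    (br : L →ₗ[R] L →ₗ[R] L →ₗ[R] L) (φ : A →ₐ[R] A) (α : L →ₗ[R] L)
    (ρ : L →ₗ[R] L →ₗ[R] A →ₗ[R] A)
    (hLR : Is3HomLR φ br α ρ)
    (β : M →ₗ[R] M) (ψ : L →ₗ[R] L →ₗ[R] M →ₗ[R] M)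
    (hmod : IsLeftModule φ br α ρ β ψ)
    (br' : (L × M) →ₗ[R] (L × M) →ₗ[R] (L × M) →ₗ[R] (L × M))
    (α' : (L × M) →ₗ[R] (L × M))
    (ρ' : (L × M) →ₗ[R] (L × M) →ₗ[R] A →ₗ[R] A)
    (hbr' : ∀ (x₁ x₂ x₃ : L) (m₁ m₂ m₃ : M),
      br' (x₁, m₁) (x₂, m₂) (x₃, m₃) =
        (br x₁ x₂ x₃, ψ x₁ x₂ m₃ + ψ x₂ x₃ m₁ + ψ x₃ x₁ m₂))
    (hα' : ∀ (x : L) (m : M), α' (x, m) = (α x, β m))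
    (hρ' : ∀ (x₁ x₂ : L) (m₁ m₂ : M), ρ' (x₁, m₁) (x₂, m₂) = ρ x₁ x₂) :
    Is3HomLR φ br' α' ρ' := by
  obtain ⟨⟨s12, s23, jac⟩, abr, asm, rder, rrep, rsl, rs, brs⟩ := hLR
  obtain ⟨⟨pskew, pcomm, r1, r2⟩, bsm, psl, ps, pl⟩ := hmod
  obtain ⟨rskew, rcomm, rr1, rr2⟩ := rrep
  have sk : ∀ x y m, ψ x y m = - ψ y x m := fun x y m => by
    rw [pskew x y]; rfl
  refine ⟨⟨?_, ?_, ?_⟩, ?_, ?_, ?_, ⟨?_, ?_, ?_, ?_⟩, ?_, ?_, ?_⟩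
  · rintro ⟨x, mx⟩ ⟨y, my⟩ ⟨z, mz⟩
    rw [hbr', hbr', Prod.neg_mk, s12 x y z, sk x y, sk y z, sk z x]
    congr 1; abel
  · rintro ⟨x, mx⟩ ⟨y, my⟩ ⟨z, mz⟩
    rw [hbr', hbr', Prod.neg_mk, s23 x y z, sk x y, sk y z, sk z x]
    congr 1; abel
  · rintro ⟨x, mx⟩ ⟨y, my⟩ ⟨u, mu⟩ ⟨v, mv⟩ ⟨w, mw⟩
    simp only [hbr', hα', Prod.mk_add_mk]
    rw [jac x y u v w]
    congr 1
    simp only [map_add]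
    have ew := r1 x y u v mw
    have eu := r1 x y v w mu
    have ev := r1 x y w u mv
    have ex := r2 u v w y mx
    have ey := r2 u v w x my
    rw [sk (α y) (br u v w), ex, ey, sk u y mx, sk v y mx, sk w y mx, ew, eu, ev]
    simp only [map_neg]
    abel
  · rintro ⟨x, mx⟩ ⟨y, my⟩ ⟨z, mz⟩
    simp only [hbr', hα', abr, map_add, pcomm]
  · rintro a ⟨x, mx⟩
    simp only [hα', Prod.smul_mk, asm, bsm]
  · rintro ⟨x, mx⟩ ⟨y, my⟩
    rw [hρ']; exact rder x y
  · rintro ⟨x, mx⟩ ⟨y, my⟩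
    rw [hρ', hρ']; exact rskew x y
  · rintro ⟨x, mx⟩ ⟨y, my⟩ m
    simp only [hρ', hα']; exact rcomm x y m
  · rintro ⟨x, mx⟩ ⟨y, my⟩ ⟨z, mz⟩ ⟨w, mw⟩ m
    simp only [hρ', hα', hbr']; exact rr1 x y z w m
  · rintro ⟨x, mx⟩ ⟨y, my⟩ ⟨z, mz⟩ ⟨w, mw⟩ m
    simp only [hρ', hα', hbr']; exact rr2 x y z w m
  · rintro a ⟨x, mx⟩ ⟨y, my⟩
    simp only [Prod.smul_mk, hρ']; exact rsl a x y
  · rintro a ⟨x, mx⟩ ⟨y, my⟩ b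
    simp only [Prod.smul_mk, hρ']; exact rs a x y b
  · rintro ⟨x, mx⟩ ⟨y, my⟩ a ⟨z, mz⟩
    simp only [Prod.smul_mk, hρ', hα', hbr', Prod.mk_add_mk]
    rw [brs, pl, ← psl, ps, ps, smul_add, smul_add]
    congr 1; abel
end

section
/- Let (L, α) be a 3-Hom-Lie-Rinehart algebra over (A, φ), M an A-module, β ∈ End_R(M) with β(a·m) = φ(a)·β(m), and ψ : L×L → End_R(M) a skew-symmetric bilinear map. Suppose (A, L ⊕ M, [·,·,·]', φ, α ⊕ β, ρ_{L⊕M}) is a 3-Hom-Lie-Rinehart algebra over (A, φ), where (α ⊕ β)(x₁ + m₁) := α(x₁) + β(m₁), [x₁ + m₁, x₂ + m₂, x₃ + m₃]' := [x₁, x₂, x₃] + ψ(x₁, x₂)m₃ + ψ(x₂, x₃)m₁ + ψ(x₃, x₁)m₂, and ρ_{L⊕M}(x₁ + m₁, x₂ + m₂) := ρ(x₁, x₂). Then (M, β) with action ψ is a left module over (L, α). -/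
/-- Conversely, if the semidirect sum `L ⊕ M` (with the bracket built
from a skew-symmetric bilinear map `ψ`, the twist `α ⊕ β`, and the anchor
`ρ_{L⊕M}(x₁+m₁, x₂+m₂) = ρ(x₁,x₂)`) is a 3-Hom-Lie-Rinehart algebra over `(A, φ)`,
then `(M, β)` with the action `ψ` is a left module over `(L, α)`. -/
theorem leftModule_of_semidirect_sum_threeHomLieRinehart
    {R A L M : Type*} [CommRing R] [CommRing A] [Algebra R A]
    [AddCommGroup L] [Module R L] [Module A L] [IsScalarTower R A L]
    [AddCommGroup M] [Module R M] [Module A M] [IsScalarTower R A M]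
    (br : L →ₗ[R] L →ₗ[R] L →ₗ[R] L) (φ : A →ₐ[R] A) (α : L →ₗ[R] L)
    (ρ : L →ₗ[R] L →ₗ[R] A →ₗ[R] A)
    (hLR : Is3HomLR φ br α ρ)
    (β : M →ₗ[R] M)
    (hβ : ∀ (a : A) (m : M), β (a • m) = φ a • β m)
    (ψ : L →ₗ[R] L →ₗ[R] M →ₗ[R] M)
    (hψskew : ∀ x y, ψ x y = - ψ y x)
    (br' : (L × M) →ₗ[R] (L × M) →ₗ[R] (L × M) →ₗ[R] (L × M))
    (α' : (L × M) →ₗ[R] (L × M))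
    (ρ' : (L × M) →ₗ[R] (L × M) →ₗ[R] A →ₗ[R] A)
    (hbr' : ∀ (x₁ x₂ x₃ : L) (m₁ m₂ m₃ : M),
      br' (x₁, m₁) (x₂, m₂) (x₃, m₃) =
        (br x₁ x₂ x₃, ψ x₁ x₂ m₃ + ψ x₂ x₃ m₁ + ψ x₃ x₁ m₂))
    (hα' : ∀ (x : L) (m : M), α' (x, m) = (α x, β m))
    (hρ' : ∀ (x₁ x₂ : L) (m₁ m₂ : M), ρ' (x₁, m₁) (x₂, m₂) = ρ x₁ x₂)
    (hLR' : Is3HomLR φ br' α' ρ') :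
    IsLeftModule φ br α ρ β ψ := by
  have smul_l : ∀ (a : A) (x y : L) (m : M), ψ (a • x) y m = φ (φ a) • ψ x y m := by
    intro a x y m
    have h := hLR'.br_smul (y, 0) (0, m) a (x, 0)
    have h2 := congrArg Prod.snd h
    simpa [hbr', hα', hρ'] using h2
  have skew_m : ∀ x y m, ψ x y m = - ψ y x m := by
    intro x y m
    rw [hψskew x y]; rfl
  refine ⟨⟨hψskew, ?_, ?_, ?_⟩, hβ, ?_, smul_l, ?_⟩
  · intro x y m
    have h := congrArg Prod.snd (hLR'.alpha_br (x, 0) (y, 0) (0, m))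
    simpa [hbr', hα', eq_comm] using h
  · intro x₁ x₂ x₃ x₄ m
    have h := congrArg Prod.snd
      (hLR'.toIs3HomLie.jacobi (x₁, 0) (x₂, 0) (x₃, 0) (x₄, 0) (0, m))
    simp [hbr', hα'] at h
    rw [h]; abel
  · intro x₁ x₂ x₃ x₄ m
    have h := congrArg Prod.snd
      (hLR'.toIs3HomLie.jacobi (x₄, 0) (0, m) (x₁, 0) (x₂, 0) (x₃, 0))
    simp [hbr', hα'] at h
    rw [h]; abel
  · intro a x y
    ext m
    rw [smul_l, skew_m x (a • y), smul_l, skew_m x y, smul_neg]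
  · intro x y a m
    have h := congrArg Prod.snd (hLR'.br_smul (x, 0) (y, 0) a (0, m))
    simpa [hbr', hα', hρ'] using h
end

section
/- Let (L, α) be a 3-Hom-Lie-Rinehart algebra over (A, φ) with φ an algebra automorphism, and let (M, β) be a left module over (L, α) with action ψ. Then the differential δ on the graded space C*(L; M) = ⊕_{n≥1} Cⁿ(L; M) satisfies δ ∘ δ = 0; in particular (C*(L; M), δ) is a cochain complex. -/
section Cochain

variable {R A L M : Type*} [CommRing R] [CommRing A] [Algebra R A]
  [AddCommGroup L] [Module R L] [Module A L] [IsScalarTower R A L]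
  [AddCommGroup M] [Module R M] [Module A M] [IsScalarTower R A M]

/-- `f` is an `n`-cochain of the 3-Hom-Lie-Rinehart algebra `(L, α)` with coefficients
in the left module `(M, β)`:  it is `R`-multilinear in its `2n+1` arguments, skew
symmetric in each pair `(x_{2k-1}, x_{2k})`, compatible with `(α, β)`, and
`φ^{2n+1}`-function-linear over `A` in each argument. -/
def IsCochain (φ : A →ₐ[R] A) (α : L →ₗ[R] L) (β : M →ₗ[R] M) (n : ℕ)
    (f : (Fin (2 * n + 1) → L) → M) : Prop :=
  (∀ (x : Fin (2 * n + 1) → L) (i : Fin (2 * n + 1)) (u v : L),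
      f (Function.update x i (u + v)) = f (Function.update x i u) + f (Function.update x i v)) ∧
  (∀ (x : Fin (2 * n + 1) → L) (i : Fin (2 * n + 1)) (r : R) (u : L),
      f (Function.update x i (r • u)) = r • f (Function.update x i u)) ∧
  (∀ (x : Fin (2 * n + 1) → L) (k : ℕ) (hk : k < n),
      f (x ∘ Equiv.swap ⟨2 * k, by omega⟩ ⟨2 * k + 1, by omega⟩) = - f x) ∧
  (∀ x : Fin (2 * n + 1) → L, f (fun i => α (x i)) = β (f x)) ∧
  (∀ (x : Fin (2 * n + 1) → L) (i : Fin (2 * n + 1)) (a : A),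
      f (Function.update x i (a • x i)) = (⇑φ)^[2 * n + 1] a • f x)

/-- The coboundary map `δ : Cⁿ(L; M) → C^{n+1}(L; M)` of the cochain complex of a
3-Hom-Lie-Rinehart algebra with coefficients in a left module. -/
def cochainDiff (br : L →ₗ[R] L →ₗ[R] L →ₗ[R] L) (α : L →ₗ[R] L)
    (ψ : L →ₗ[R] L →ₗ[R] M →ₗ[R] M) (n : ℕ)
    (f : (Fin (2 * n + 1) → L) → M) : (Fin (2 * n + 3) → L) → M := fun x =>
  ((-1 : ℤ) ^ (n + 2) •
      ψ ((⇑α)^[n + 1] (x ⟨2 * n + 2, by omega⟩)) ((⇑α)^[n + 1] (x ⟨2 * n, by omega⟩))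
        (f fun i => x (if (i : ℕ) < 2 * n then Fin.castLE (by omega) i
          else ⟨2 * n + 1, by omega⟩)))
  + ((-1 : ℤ) ^ (n + 2) •
      ψ ((⇑α)^[n + 1] (x ⟨2 * n + 1, by omega⟩)) ((⇑α)^[n + 1] (x ⟨2 * n + 2, by omega⟩))
        (f fun i => x (Fin.castLE (by omega) i)))
  + (∑ k : Fin (n + 1), (-1 : ℤ) ^ (k : ℕ) •
      ψ ((⇑α)^[n + 1] (x ⟨2 * (k : ℕ), by have := k.isLt; omega⟩))
        ((⇑α)^[n + 1] (x ⟨2 * (k : ℕ) + 1, by have := k.isLt; omega⟩))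
        (f fun i => x (if (i : ℕ) < 2 * (k : ℕ) then Fin.castLE (by omega) i
          else i.addNat 2)))
  + (∑ k : Fin (n + 1),
      ∑ j ∈ Finset.univ.filter (fun j : Fin (2 * n + 3) => 2 * (k : ℕ) + 1 < (j : ℕ)),
      (-1 : ℤ) ^ ((k : ℕ) + 1) •
      f (fun i =>
        let t : Fin (2 * n + 3) :=
          if (i : ℕ) < 2 * (k : ℕ) then Fin.castLE (by omega) i else i.addNat 2
        if (t : ℕ) = (j : ℕ) then
          br (x ⟨2 * (k : ℕ), by have := k.isLt; omega⟩)
            (x ⟨2 * (k : ℕ) + 1, by have := k.isLt; omega⟩) (x j)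
        else α (x t)))

end Cochain
namespace HLR

set_option linter.unusedSectionVars false

section Aux

variable {R L M : Type*} [CommRing R] [AddCommGroup L] [Module R L] [AddCommGroup M] [Module R M]

/-- Apply `α` to all entries of a list of pairs. -/
def lm (α : L →ₗ[R] L) (l : List (L × L)) : List (L × L) := l.map (fun p => (α p.1, α p.2))

/-- The sum over all slots of `g` with the bracket `[a, b, ·]` inserted in one slot and
`α` in the others. -/
def act (br : L →ₗ[R] L →ₗ[R] L →ₗ[R] L) (α : L →ₗ[R] L) (a b : L) :
    (List (L × L) → L → M) → List (L × L) → L → M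
  | g, [], z => g [] (br a b z)
  | g, (c, d) :: l, z =>
      g ((br a b c, α d) :: lm α l) (α z) + g ((α c, br a b d) :: lm α l) (α z)
        + act br α a b (fun l' => g ((α c, α d) :: l')) l z

/-- The twisted action of a pair. -/
def pp (α : L →ₗ[R] L) (ψ : L →ₗ[R] L →ₗ[R] M →ₗ[R] M) (m : ℕ) (a b : L) : M →ₗ[R] M :=
  ψ ((⇑α)^[m] a) ((⇑α)^[m] b)

/-- Lie derivative along a pair. -/
def lie (br : L →ₗ[R] L →ₗ[R] L →ₗ[R] L) (α : L →ₗ[R] L)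
    (ψ : L →ₗ[R] L →ₗ[R] M →ₗ[R] M) (m : ℕ) (a b : L)
    (f f' : List (L × L) → L → M) (l : List (L × L)) (z : L) : M :=
  pp α ψ (m + 1) a b (f l z) - act br α a b f' l z

/-- The recursive form of the differential. -/
def dd (br : L →ₗ[R] L →ₗ[R] L →ₗ[R] L) (α : L →ₗ[R] L)
    (ψ : L →ₗ[R] L →ₗ[R] M →ₗ[R] M) (m : ℕ) :
    (f f' : List (L × L) → L → M) → List (L × L) → L → M
  | _, _, [], _ => 0
  | f, f', [(a, b)], z => lie br α ψ m a b f f' [] z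
      + pp α ψ (m + 1) z a (f [] b) + pp α ψ (m + 1) b z (f [] a)
  | f, f', (a, b) :: c :: l, z => lie br α ψ m a b f f' (c :: l) z
      - dd br α ψ m (fun l' => f ((a, b) :: l')) (fun l' => f' ((α a, α b) :: l')) (c :: l) z

variable (br : L →ₗ[R] L →ₗ[R] L →ₗ[R] L) (α : L →ₗ[R] L)
  (ψ : L →ₗ[R] L →ₗ[R] M →ₗ[R] M) (β : M →ₗ[R] M)

theorem act_congr (a b : L) (l : List (L × L)) : ∀ (g h : List (L × L) → L → M) (z : L),
    (∀ l' z', l'.length = l.length → g l' z' = h l' z') →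
    act br α a b g l z = act br α a b h l z := by
  induction l with
  | nil => intro g h z H; simpa [act] using H _ _ rfl
  | cons c l ih =>
    intro g h z H
    obtain ⟨c, d⟩ := c
    simp only [act]
    rw [H _ _ (by simp [lm]), H _ _ (by simp [lm]),
      ih _ (fun l' => h ((α c, α d) :: l')) z (fun l' z' hl => H _ _ (by simp [hl]))]

theorem dd_congr (m : ℕ) (l : List (L × L)) : ∀ (f f' g g' : List (L × L) → L → M) (z : L),
    (∀ l' z', l'.length + 1 = l.length → f l' z' = g l' z') →
    (∀ l' z', l'.length + 1 = l.length → f' l' z' = g' l' z') →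
    dd br α ψ m f f' l z = dd br α ψ m g g' l z := by
  induction l with
  | nil => intros; rfl
  | cons c l ih =>
    intro f f' g g' z H H'
    obtain ⟨a, b⟩ := c
    cases l with
    | nil =>
      simp only [dd, lie, act]
      rw [H _ _ (by simp), H _ _ (by simp), H _ _ (by simp), H' _ _ (by simp)]
    | cons c l =>
      simp only [dd, lie]
      rw [H _ _ (by simp), act_congr br α a b (c :: l) f' g' z (fun l' z' hl => H' _ _ (by simp [hl])),
        ih _ _ (fun l' => g ((a, b) :: l')) (fun l' => g' ((α a, α b) :: l')) z
          (fun l' z' hl => H _ _ (by simpa using hl))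
          (fun l' z' hl => H' _ _ (by simpa using hl))]

theorem act_add (a b : L) (l : List (L × L)) : ∀ (g h : List (L × L) → L → M) (z : L),
    act br α a b (fun l z => g l z + h l z) l z = act br α a b g l z + act br α a b h l z := by
  induction l with
  | nil => intros; rfl
  | cons c l ih =>
    intro g h z
    obtain ⟨c, d⟩ := c
    simp only [act, ih (fun l' => g ((α c, α d) :: l')) (fun l' => h ((α c, α d) :: l')) z]
    abel

theorem act_map (p : M →ₗ[R] M) (a b : L) (l : List (L × L)) :
    ∀ (g : List (L × L) → L → M) (z : L),
    act br α a b (fun l z => p (g l z)) l z = p (act br α a b g l z) := by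
  induction l with
  | nil => intros; rfl
  | cons c l ih =>
    intro g z
    obtain ⟨c, d⟩ := c
    simp only [act, ih (fun l' => g ((α c, α d) :: l')) z, map_add]

theorem act_sub (a b : L) (l : List (L × L)) (g h : List (L × L) → L → M) (z : L) :
    act br α a b (fun l z => g l z - h l z) l z = act br α a b g l z - act br α a b h l z := by
  have h1 := act_add br α a b l (fun l z => g l z - h l z) h z
  simp only [sub_add_cancel] at h1
  rw [eq_sub_iff_add_eq, ← h1]

theorem dd_sub (m : ℕ) (l : List (L × L)) : ∀ (f f' g g' : List (L × L) → L → M) (z : L),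
    dd br α ψ m (fun l z => f l z - g l z) (fun l z => f' l z - g' l z) l z
      = dd br α ψ m f f' l z - dd br α ψ m g g' l z := by
  induction l with
  | nil => intros; simp [dd]
  | cons c l ih =>
    intro f f' g g' z
    obtain ⟨a, b⟩ := c
    cases l with
    | nil => simp only [dd, lie, act, map_sub]; abel
    | cons c l =>
      simp only [dd, lie, map_sub, act_sub,
        ih (fun l' => f ((a, b) :: l')) (fun l' => f' ((α a, α b) :: l'))
          (fun l' => g ((a, b) :: l')) (fun l' => g' ((α a, α b) :: l')) z]
      abel


theorem act_lm (hα : ∀ x y z, α (br x y z) = br (α x) (α y) (α z))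
    (a b : L) (l : List (L × L)) : ∀ (g : List (L × L) → L → M) (z : L),
    act br α (α a) (α b) g (lm α l) (α z)
      = act br α a b (fun l z => g (lm α l) (α z)) l z := by
  induction l with
  | nil => intro g z; simp [act, lm, hα]
  | cons c l ih =>
    intro g z
    obtain ⟨c, d⟩ := c
    have := ih (fun l' => g ((α (α c), α (α d)) :: l')) z
    simp only [lm, List.map_cons, act, hα] at this ⊢
    rw [this]

theorem dd_lm (hα : ∀ x y z, α (br x y z) = br (α x) (α y) (α z))
    (m : ℕ) (l : List (L × L)) : ∀ (f f' : List (L × L) → L → M) (z : L),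
    dd br α ψ m f f' (lm α l) (α z)
      = dd br α ψ (m + 1) (fun l z => f (lm α l) (α z)) (fun l z => f' (lm α l) (α z)) l z := by
  induction l with
  | nil => intros; rfl
  | cons c l ih =>
    intro f f' z
    obtain ⟨a, b⟩ := c
    have h1 := act_lm (M := M) br α hα a b
    cases l with
    | nil =>
      have h1 := h1 [] f' z
      simp only [lm, List.map_nil, List.map_cons, dd, lie] at h1 ⊢
      rw [h1]; rfl
    | cons c l =>
      have h1 := h1 (c :: l) f' z
      have h2 := ih (fun l' => f ((α a, α b) :: l')) (fun l' => f' ((α (α a), α (α b)) :: l')) z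
      simp only [lm, List.map_cons, dd, lie] at h1 h2 ⊢
      rw [h1, h2]; rfl

/-- Additivity in every slot. -/
structure Additive3 (f : List (L × L) → L → M) : Prop where
  last : ∀ l u v, f l (u + v) = f l u + f l v
  fst : ∀ l₁ l₂ u v y z, f (l₁ ++ (u + v, y) :: l₂) z
    = f (l₁ ++ (u, y) :: l₂) z + f (l₁ ++ (v, y) :: l₂) z
  snd : ∀ l₁ l₂ u v y z, f (l₁ ++ (y, u + v) :: l₂) z
    = f (l₁ ++ (y, u) :: l₂) z + f (l₁ ++ (y, v) :: l₂) z

theorem Additive3.cons {f : List (L × L) → L → M} (hf : Additive3 f) (c : L × L) :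
    Additive3 (fun l => f (c :: l)) where
  last l := hf.last (c :: l)
  fst l := hf.fst (c :: l)
  snd l := hf.snd (c :: l)

theorem act_act (hL : Is3HomLie br α) (hα : ∀ x y z, α (br x y z) = br (α x) (α y) (α z))
    (a b c d : L) (l : List (L × L)) : ∀ (g : List (L × L) → L → M) (z : L), Additive3 g →
    act br α c d (act br α (α a) (α b) g) l z
      = act br α a b (act br α (α c) (α d) g) l z
       + act br α (br a b c) (α d) g (lm α l) (α z)
       + act br α (α c) (br a b d) g (lm α l) (α z) := by
  have J : ∀ w, br (α a) (α b) (br c d w) = br (α c) (α d) (br a b w)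
      + br (br a b c) (α d) (α w) + br (α c) (br a b d) (α w) := by
    intro w; rw [hL.jacobi]; abel
  induction l with
  | nil =>
    intro g z hg
    simp only [act, lm, List.map_nil, J, hg.last]
  | cons e l ih =>
    intro g z hg
    obtain ⟨u, v⟩ := e
    have h1 := ih (fun l' => g ((α (α u), α (α v)) :: l')) z (hg.cons _)
    have f1 : ∀ p q y l z, g ((p + q, y) :: l) z = g ((p, y) :: l) z + g ((q, y) :: l) z :=
      fun p q y l z => hg.fst [] l p q y z
    have f2 : ∀ p q y l z, g ((y, p + q) :: l) z = g ((y, p) :: l) z + g ((y, q) :: l) z :=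
      fun p q y l z => hg.snd [] l p q y z
    have e1 := act_lm (M := M) br α hα a b l
    have e2 := act_lm (M := M) br α hα c d l
    simp only [lm] at e1 e2 h1
    simp only [lm, List.map_cons, act, act_add, J, f1, f2, h1, e1, e2, hα]
    abel

/-- Compatibility of successive members of a family. -/
def Compat (f f' : List (L × L) → L → M) : Prop :=
  ∀ l z, f' (lm α l) (α z) = β (f l z)

variable {br α ψ β}

theorem iter_br (hα : ∀ x y z, α (br x y z) = br (α x) (α y) (α z)) (m : ℕ) (x y z : L) :
    (⇑α)^[m] (br x y z) = br ((⇑α)^[m] x) ((⇑α)^[m] y) ((⇑α)^[m] z) := by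
  induction m with
  | zero => rfl
  | succ m ih => simp only [Function.iterate_succ_apply', ih, hα]

theorem pp_comm (hα : ∀ x y z, α (br x y z) = br (α x) (α y) (α z)) (hr : IsRep br α ψ β)
    (m : ℕ) (a b c d : L) (v : M) :
    pp α ψ (m + 1) a b (pp α ψ m c d v) = pp α ψ (m + 1) c d (pp α ψ m a b v)
      + pp α ψ m (br a b c) (α d) (β v) + pp α ψ m (α c) (br a b d) (β v) := by
  simp only [pp, iter_br hα, ← Function.iterate_succ_apply (⇑α), Function.iterate_succ_apply']
  rw [hr.rep₁ ((⇑α)^[m] a) ((⇑α)^[m] b) ((⇑α)^[m] c) ((⇑α)^[m] d)]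
  abel

theorem pp_rep₂ (hα : ∀ x y z, α (br x y z) = br (α x) (α y) (α z)) (hr : IsRep br α ψ β)
    (m : ℕ) (a b c d : L) (v : M) :
    pp α ψ m (br a b c) (α d) (β v) = pp α ψ (m + 1) a b (pp α ψ m c d v)
      + pp α ψ (m + 1) b c (pp α ψ m a d v) + pp α ψ (m + 1) c a (pp α ψ m b d v) := by
  simp only [pp, iter_br hα, ← Function.iterate_succ_apply (⇑α), Function.iterate_succ_apply']
  rw [hr.rep₂]

theorem pp_skew (hr : IsRep br α ψ β) (m : ℕ) (a b : L) (v : M) :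
    pp α ψ m a b v = - pp α ψ m b a v := by
  simp only [pp]; rw [hr.skew]; rfl

theorem pp_alpha (m : ℕ) (a b : L) : pp α ψ m (α a) (α b) = pp α ψ (m + 1) a b := rfl

theorem lie_lie (hL : Is3HomLie br α) (hα : ∀ x y z, α (br x y z) = br (α x) (α y) (α z))
    (hr : IsRep br α ψ β) (m : ℕ) (a b c d : L) (f f' f'' : List (L × L) → L → M)
    (h1 : Compat α β f f') (hf : Additive3 f'') (l : List (L × L)) (z : L) :
    lie br α ψ (m + 1) a b (lie br α ψ m c d f f') (lie br α ψ m (α c) (α d) f' f'') l z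
      = lie br α ψ (m + 1) c d (lie br α ψ m a b f f') (lie br α ψ m (α a) (α b) f' f'') l z
        + lie br α ψ m (br a b c) (α d) f' f'' (lm α l) (α z)
        + lie br α ψ m (α c) (br a b d) f' f'' (lm α l) (α z) := by
  have E : ∀ a b c d : L, act br α a b (lie br α ψ m (α c) (α d) f' f'') l z
      = pp α ψ (m + 2) c d (act br α a b f' l z)
        - act br α a b (act br α (α c) (α d) f'') l z := by
    intro a b c d
    rw [← act_map, ← act_sub]; rfl
  have h2 := act_act br α hL hα a b c d l f'' z hf
  simp only [lie] at E ⊢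
  rw [E, E]
  rw [h1, h2, map_sub, map_sub, pp_comm hα hr (m + 1) a b c d]
  abel

theorem lie_dd (hL : Is3HomLie br α) (hα : ∀ x y z, α (br x y z) = br (α x) (α y) (α z))
    (hr : IsRep br α ψ β) (m : ℕ) (a b : L) (l : List (L × L)) :
    ∀ (f f' f'' : List (L × L) → L → M) (z : L), l ≠ [] →
    Compat α β f f' → Compat α β f' f'' → Additive3 f'' →
    lie br α ψ (m + 1) a b (dd br α ψ m f f') (dd br α ψ m f' f'') l z
      = dd br α ψ (m + 1) (lie br α ψ m a b f f') (lie br α ψ m (α a) (α b) f' f'') l z := by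
  induction l with
  | nil => intro f f' f'' z h; exact absurd rfl h
  | cons e l ih =>
    intro f f' f'' z _ h1 h2 hf
    obtain ⟨c, d⟩ := e
    cases l with
    | nil =>
      have K := lie_lie hL hα hr m a b c d f f' f'' h1 hf [] z
      have h1' : ∀ z, f' [] (α z) = β (f [] z) := h1 []
      have c1 := pp_comm hα hr (m + 1) a b z c (f [] d)
      have c2 := pp_comm hα hr (m + 1) a b d z (f [] c)
      simp only [lie, dd, act, lm, List.map_nil, map_add, map_sub, pp_alpha, h1'] at K c1 c2 ⊢
      rw [c1, c2]
      generalize pp α ψ (m + 1 + 1) = P at *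
      rw [← sub_eq_zero] at K ⊢
      rw [← K]
      abel
    | cons e l =>
      have K := lie_lie hL hα hr m a b c d f f' f'' h1 hf (e :: l) z
      have I := ih (fun l' => f ((c, d) :: l')) (fun l' => f' ((α c, α d) :: l'))
        (fun l' => f'' ((α (α c), α (α d)) :: l')) z (by simp)
        (fun l' => h1 ((c, d) :: l')) (fun l' => h2 ((α c, α d) :: l')) (hf.cons _)
      -- left-hand side
      have A1 : ∀ u v : L, dd br α ψ m f' f'' ((u, v) :: lm α (e :: l)) (α z)
          = lie br α ψ m u v f' f'' (lm α (e :: l)) (α z)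
            - dd br α ψ (m + 1) (fun l z => f' ((u, v) :: lm α l) (α z))
                (fun l z => f'' ((α u, α v) :: lm α l) (α z)) (e :: l) z := by
        intro u v
        rw [← dd_lm br α ψ hα m (e :: l) (fun l => f' ((u, v) :: l))
          (fun l => f'' ((α u, α v) :: l)) z]
        rfl
      have A2 : act br α a b (fun l => dd br α ψ m f' f'' ((α c, α d) :: l)) (e :: l) z
          = act br α a b (lie br α ψ m (α c) (α d) f' f'') (e :: l) z
            - act br α a b (dd br α ψ m (fun l' => f' ((α c, α d) :: l'))
              (fun l' => f'' ((α (α c), α (α d)) :: l'))) (e :: l) z := by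
        rw [← act_sub]
        apply act_congr
        intro l' z' hl
        cases l' with
        | nil => simp at hl
        | cons e' l' => rfl
      have A3 : lie br α ψ (m + 1) a b (dd br α ψ m f f') (dd br α ψ m f' f'')
          ((c, d) :: e :: l) z = pp α ψ (m + 2) a b (dd br α ψ m f f' ((c, d) :: e :: l) z)
          - (dd br α ψ m f' f'' ((br a b c, α d) :: lm α (e :: l)) (α z)
            + dd br α ψ m f' f'' ((α c, br a b d) :: lm α (e :: l)) (α z)
            + act br α a b (fun l => dd br α ψ m f' f'' ((α c, α d) :: l)) (e :: l) z) := rfl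
      -- right-hand side
      have B1 : dd br α ψ (m + 1) (lie br α ψ m a b f f') (lie br α ψ m (α a) (α b) f' f'')
          ((c, d) :: e :: l) z
          = lie br α ψ (m + 1) c d (lie br α ψ m a b f f')
              (lie br α ψ m (α a) (α b) f' f'') (e :: l) z
            - dd br α ψ (m + 1)
              (fun l z => lie br α ψ m a b (fun l' => f ((c, d) :: l'))
                (fun l' => f' ((α c, α d) :: l')) l z
                - f' ((br a b c, α d) :: lm α l) (α z) - f' ((α c, br a b d) :: lm α l) (α z))
              (fun l z => lie br α ψ m (α a) (α b) (fun l' => f' ((α c, α d) :: l'))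
                (fun l' => f'' ((α (α c), α (α d)) :: l')) l z
                - f'' ((α (br a b c), α (α d)) :: lm α l) (α z)
                - f'' ((α (α c), α (br a b d)) :: lm α l) (α z)) (e :: l) z := by
        rw [dd]
        congr 1
        congr 1 <;> funext l z <;> simp only [lie, act, hα] <;> abel
      rw [dd_sub br α ψ, dd_sub br α ψ, ← I] at B1
      rw [A3, A1, A2, A1, B1, dd]
      have K' := sub_eq_zero.2 K
      rw [← sub_eq_zero, ← K']
      simp only [lie, map_sub]
      abel

theorem dd_dd (hL : Is3HomLie br α) (hα : ∀ x y z, α (br x y z) = br (α x) (α y) (α z))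
    (hr : IsRep br α ψ β) (m : ℕ) (l : List (L × L)) :
    ∀ (f f' f'' : List (L × L) → L → M) (z : L), 2 ≤ l.length →
    Compat α β f f' → Compat α β f' f'' → Additive3 f'' →
    dd br α ψ (m + 1) (dd br α ψ m f f') (dd br α ψ m f' f'') l z = 0 := by
  induction l with
  | nil => intro f f' f'' z h; simp at h
  | cons e l ih =>
    intro f f' f'' z h h1 h2 hf
    obtain ⟨a, b⟩ := e
    cases l with
    | nil => simp at h
    | cons e l =>
      have K := lie_dd hL hα hr m a b (e :: l) f f' f'' z (by simp) h1 h2 hf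
      rw [dd, K]
      cases l with
      | nil =>
        obtain ⟨c, d⟩ := e
        have h1' : ∀ z, f' [] (α z) = β (f [] z) := h1 []
        have r1 := pp_rep₂ hα hr (m + 1) c d z a (f [] b)
        have r2 := pp_rep₂ hα hr (m + 1) c d z b (f [] a)
        have s1 := pp_skew hr (m + 1) b (br c d z)
        simp only [dd, lie, act, map_add, map_sub, pp_alpha, h1'] at r1 r2 ⊢
        have s1 := pp_skew hr (m + 1) (α b) (br c d z) (β (f [] a))
        have s2 := pp_skew hr (m + 1) b z (f [] a)
        have s3 := pp_skew hr (m + 1) b c (f [] a)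
        have s4 := pp_skew hr (m + 1) b d (f [] a)
        rw [s1, r1, r2, s2, s3, s4]
        simp only [map_neg]
        abel
      | cons e' l =>
        have I := ih (fun l' => f ((a, b) :: l')) (fun l' => f' ((α a, α b) :: l'))
          (fun l' => f'' ((α (α a), α (α b)) :: l')) z (by simp)
          (fun l' => h1 ((a, b) :: l')) (fun l' => h2 ((α a, α b) :: l')) (hf.cons _)
        have B := dd_sub br α ψ (m + 1) (e :: e' :: l) (lie br α ψ m a b f f')
          (lie br α ψ m (α a) (α b) f' f'')
          (dd br α ψ m (fun l' => f ((a, b) :: l')) (fun l' => f' ((α a, α b) :: l')))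
          (dd br α ψ m (fun l' => f' ((α a, α b) :: l'))
            (fun l' => f'' ((α (α a), α (α b)) :: l'))) z
        rw [I, sub_zero] at B
        rw [← B, sub_eq_zero]
        apply dd_congr
        · intro l' z' hl
          cases l' with
          | nil => simp at hl
          | cons c l' => rfl
        · intro l' z' hl
          cases l' with
          | nil => simp at hl
          | cons c l' => rfl

end Aux

end HLR
namespace HLR

section Bridge

variable {R L M : Type*} [CommRing R] [AddCommGroup L] [Module R L] [AddCommGroup M] [Module R M]

/-- Prepend a pair to a sequence. -/
def cns (a b : L) (y : ℕ → L) : ℕ → L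
  | 0 => a
  | 1 => b
  | k + 2 => y k

/-- The sequence attached to a list of pairs and a last entry. -/
def flat : List (L × L) → L → ℕ → L
  | [], z => fun _ => z
  | (a, b) :: l, z => cns a b (flat l z)

/-- The sequence version of the differential, with all parameters decoupled. -/
def ex (br : L →ₗ[R] L →ₗ[R] L →ₗ[R] L) (α : L →ₗ[R] L)
    (ψ : L →ₗ[R] L →ₗ[R] M →ₗ[R] M) (m n : ℕ) (F F' : (ℕ → L) → M) (x : ℕ → L) : M :=
  ((-1 : ℤ) ^ (n + 2) • pp α ψ (m + 1) (x (2 * n + 2)) (x (2 * n))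
      (F fun i => if i < 2 * n then x i else x (2 * n + 1)))
  + ((-1 : ℤ) ^ (n + 2) • pp α ψ (m + 1) (x (2 * n + 1)) (x (2 * n + 2))
      (F fun i => if i < 2 * n then x i else x (2 * n)))
  + (∑ k ∈ Finset.range (n + 1), (-1 : ℤ) ^ k • pp α ψ (m + 1) (x (2 * k)) (x (2 * k + 1))
      (F fun i => if i < 2 * k then x i else x (i + 2)))
  + (∑ k ∈ Finset.range (n + 1), ∑ j ∈ Finset.range (2 * n + 3), if 2 * k + 1 < j then
      (-1 : ℤ) ^ (k + 1) • F' (fun i =>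
        if i < 2 * k then α (x i) else
          if min (i + 2) (2 * n + 2) = j then br (x (2 * k)) (x (2 * k + 1)) (x j)
          else α (x (i + 2))) else 0)

variable (br : L →ₗ[R] L →ₗ[R] L →ₗ[R] L) (α : L →ₗ[R] L)
  (ψ : L →ₗ[R] L →ₗ[R] M →ₗ[R] M)

theorem flat_lm (l : List (L × L)) (z : L) : ∀ i, flat (lm α l) (α z) i = α (flat l z i) := by
  induction l with
  | nil => intro i; rfl
  | cons c l ih =>
    intro i
    match i with
    | 0 => rfl
    | 1 => rfl
    | i + 2 => exact ih i

theorem sum_act (a b : L) (l : List (L × L)) : ∀ (F : (ℕ → L) → M) (z : L),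
    ∑ j ∈ Finset.range (2 * l.length + 1), F (fun i => if min i (2 * l.length) = j then
      br a b (flat l z j) else α (flat l z i)) = act br α a b (fun l z => F (flat l z)) l z := by
  induction l with
  | nil => intro F z; simp [act, flat]
  | cons c l ih =>
    intro F z
    obtain ⟨c, d⟩ := c
    have h := ih (fun y => F (cns (α c) (α d) y)) z
    have e : 2 * ((c, d) :: l).length + 1 = 2 * l.length + 1 + 1 + 1 := by simp; ring
    rw [e, Finset.sum_range_succ', Finset.sum_range_succ', act]
    change _ = F _ + F _ + act br α a b (fun l z => F (cns (α c) (α d) (flat l z))) l z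
    rw [← h, add_assoc, add_comm]
    congr 1
    · rw [add_comm (F _) (F _)]
      congr 2
      · funext i
        match i with
        | 0 => simp [flat, cns]
        | 1 => simp [flat, cns]
        | i + 2 => simp [flat, cns, flat_lm]
      · funext i
        match i with
        | 0 => simp [flat, cns]
        | 1 =>
          have : min 1 (2 * (l.length + 1)) = 1 := by omega
          simp [flat, cns, this]
        | i + 2 =>
          have : ¬ min (i + 2) (2 * (l.length + 1)) = 1 := by omega
          simp [flat, cns, flat_lm, this]
    · apply Finset.sum_congr rfl
      intro j hj
      congr 1
      funext i
      match i with
      | 0 => simp [flat, cns]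
      | 1 =>
          have : ¬ min 1 (2 * (l.length + 1)) = j + 1 + 1 := by omega
          simp [flat, cns, this]
      | i + 2 =>
          have : (min (i + 2) (2 * (l.length + 1)) = j + 1 + 1) ↔ min i (2 * l.length) = j := by
            omega
          simp [flat, cns, this]

theorem ex_succ (m n : ℕ) (F F' : (ℕ → L) → M) (a b : L) (x : ℕ → L) :
    ex br α ψ m (n + 1) F F' (cns a b x) =
      pp α ψ (m + 1) a b (F x)
      - (∑ j ∈ Finset.range (2 * (n + 1) + 1), F' (fun i => if min i (2 * (n + 1)) = j then
          br a b (x j) else α (x i)))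
      - ex br α ψ m n (fun y => F (cns a b y)) (fun y => F' (cns (α a) (α b) y)) x := by
  have S1 : ∑ k ∈ Finset.range (n + 1 + 1), (-1 : ℤ) ^ k •
      pp α ψ (m + 1) (cns a b x (2 * k)) (cns a b x (2 * k + 1))
      (F fun i => if i < 2 * k then cns a b x i else cns a b x (i + 2))
      = pp α ψ (m + 1) a b (F x) -
        ∑ k ∈ Finset.range (n + 1), (-1 : ℤ) ^ k • pp α ψ (m + 1) (x (2 * k)) (x (2 * k + 1))
        (F (cns a b fun i => if i < 2 * k then x i else x (i + 2))) := by
    rw [Finset.sum_range_succ', add_comm, sub_eq_add_neg, ← Finset.sum_neg_distrib]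
    congr 1
    · simp [cns]
    · apply Finset.sum_congr rfl
      intro k _
      rw [pow_succ, mul_neg_one, neg_smul]
      congr 3
      congr 1
      funext i
      match i with
      | 0 => simp [cns]
      | 1 =>
        have : 1 < 2 * (k + 1) := by omega
        simp [cns, this]
      | i + 2 =>
        have : i + 2 < 2 * (k + 1) ↔ i < 2 * k := by omega
        simp [cns, this]
  have S2 : ∑ k ∈ Finset.range (n + 1 + 1), (∑ j ∈ Finset.range (2 * (n + 1) + 3),
      if 2 * k + 1 < j then
      (-1 : ℤ) ^ (k + 1) • F' (fun i =>
        if i < 2 * k then α (cns a b x i) else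
          if min (i + 2) (2 * (n + 1) + 2) = j then
            br (cns a b x (2 * k)) (cns a b x (2 * k + 1)) (cns a b x j)
          else α (cns a b x (i + 2))) else 0)
      = - (∑ j ∈ Finset.range (2 * (n + 1) + 1), F' (fun i => if min i (2 * (n + 1)) = j then
          br a b (x j) else α (x i))) -
        ∑ k ∈ Finset.range (n + 1), ∑ j ∈ Finset.range (2 * n + 3), (if 2 * k + 1 < j then
      (-1 : ℤ) ^ (k + 1) • F' (cns (α a) (α b) fun i =>
        if i < 2 * k then α (x i) else
          if min (i + 2) (2 * n + 2) = j then br (x (2 * k)) (x (2 * k + 1)) (x j)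
          else α (x (i + 2))) else 0) := by
    rw [Finset.sum_range_succ', add_comm, sub_eq_add_neg, ← Finset.sum_neg_distrib,
      ← Finset.sum_neg_distrib]
    congr 1
    · rw [Finset.sum_range_succ', Finset.sum_range_succ']
      simp [cns]
    · apply Finset.sum_congr rfl
      intro k _
      have e : 2 * (n + 1) + 3 = 2 * n + 3 + 1 + 1 := by ring
      rw [e, Finset.sum_range_succ', Finset.sum_range_succ', if_neg (by omega), if_neg (by omega),
        add_zero, add_zero, ← Finset.sum_neg_distrib]
      apply Finset.sum_congr rfl
      intro j _
      have : 2 * (k + 1) + 1 < j + 1 + 1 ↔ 2 * k + 1 < j := by omega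
      simp only [this]
      split_ifs with hj
      · rw [pow_succ, mul_neg_one, neg_smul]
        congr 3
        funext i
        match i with
        | 0 => simp [cns]
        | 1 =>
          have : 1 < 2 * (k + 1) := by omega
          simp [cns, this]
        | i + 2 =>
          have h1 : i + 2 < 2 * (k + 1) ↔ i < 2 * k := by omega
          have h2 : min (i + 2 + 2) (2 * (n + 1) + 2) = j + 1 + 1
            ↔ min (i + 2) (2 * n + 2) = j := by omega
          simp only [cns, h1, h2]
          rfl
      · simp
  have S3 : ∀ c : L, (fun i => if i < 2 * (n + 1) then cns a b x i else c)
      = cns a b (fun i => if i < 2 * n then x i else c) := by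
    intro c
    funext i
    match i with
    | 0 => simp [cns]
    | 1 =>
      have : 1 < 2 * (n + 1) := by omega
      simp [cns, this]
    | i + 2 =>
      have : i + 2 < 2 * (n + 1) ↔ i < 2 * n := by omega
      simp only [cns, this]
  rw [ex, S1, S2, S3, S3, ex]
  have p : (-1 : ℤ) ^ (n + 1 + 2) = - (-1) ^ (n + 2) := by ring
  rw [p, neg_smul, neg_smul]
  have t0 : cns a b x (2 * (n + 1)) = x (2 * n) := rfl
  have t1 : cns a b x (2 * (n + 1) + 1) = x (2 * n + 1) := rfl
  have t2 : cns a b x (2 * (n + 1) + 2) = x (2 * n + 2) := rfl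
  rw [t0, t1, t2]
  abel

theorem ex_eq_dd (m : ℕ) (l : List (L × L)) : ∀ (n : ℕ) (F F' : (ℕ → L) → M) (z : L),
    l.length = n + 1 → ex br α ψ m n F F' (flat l z)
      = dd br α ψ m (fun l z => F (flat l z)) (fun l z => F' (flat l z)) l z := by
  induction l with
  | nil => intro n F F' z h; simp at h
  | cons c l ih =>
    intro n F F' z h
    obtain ⟨a, b⟩ := c
    cases l with
    | nil =>
      obtain rfl : n = 0 := by simpa using h.symm
      simp [ex, dd, lie, act, flat, cns, Finset.sum_range_succ]
      abel
    | cons c l =>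
      obtain ⟨n, rfl⟩ : ∃ k, n = k + 1 := ⟨l.length, by simpa using h.symm⟩
      have hl : (c :: l).length = n + 1 := by simpa using h
      have := sum_act br α a b (c :: l) F' z
      rw [flat, ex_succ, dd, lie, ← this, hl, ih n _ _ z hl]
      rfl

theorem exists_flat (n : ℕ) : ∀ x : Fin (2 * n + 1) → L,
    ∃ l z, l.length = n ∧ ∀ i : Fin (2 * n + 1), x i = flat l z i := by
  induction n with
  | zero =>
    intro x
    refine ⟨[], x 0, rfl, fun i => ?_⟩
    have : i = 0 := by ext; have := i.isLt; simp
    rw [this]; rfl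
  | succ n ih =>
    intro x
    obtain ⟨l, z, h, hx⟩ := ih (fun i => x ⟨i + 2, by omega⟩)
    refine ⟨(x ⟨0, by omega⟩, x ⟨1, by omega⟩) :: l, z, by simp [h], ?_⟩
    rintro ⟨i, hi⟩
    match i, hi with
    | 0, _ => rfl
    | 1, _ => rfl
    | i + 2, hi => exact hx ⟨i, by omega⟩

theorem cochainDiff_eq_ex (n : ℕ) (f : (Fin (2 * n + 1) → L) → M) (x : ℕ → L) :
    cochainDiff br α ψ n f (fun i => x i)
      = ex br α ψ n n (fun y => f fun i => y i) (fun y => f fun i => y i) x := by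
  have S1 := Finset.sum_range (n := n + 1)
    (fun k => (-1 : ℤ) ^ k • pp α ψ (n + 1) (x (2 * k)) (x (2 * k + 1))
      (f fun i : Fin (2 * n + 1) => if (i : ℕ) < 2 * k then x i else x (i + 2)))
  have S2 := Finset.sum_range (n := n + 1)
    (fun k => ∑ j ∈ Finset.range (2 * n + 3), if 2 * k + 1 < j then
      (-1 : ℤ) ^ (k + 1) • f (fun i : Fin (2 * n + 1) =>
        if (i : ℕ) < 2 * k then α (x i) else
          if min ((i : ℕ) + 2) (2 * n + 2) = j then br (x (2 * k)) (x (2 * k + 1)) (x j)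
          else α (x (i + 2))) else 0)
  rw [ex, S1, S2, cochainDiff]
  congr 1
  · congr 1
    · congr 1
      · simp only [pp]
        congr 3
        funext i
        split_ifs <;> rfl
      · simp only [pp]
        congr 3
        funext i
        split_ifs with h
        · rfl
        · have : (i : ℕ) = 2 * n := by have := i.isLt; omega
          simp [this]
    · apply Finset.sum_congr rfl
      intro k _
      simp only [pp]
      congr 3
      funext i
      split_ifs <;> rfl
  · apply Finset.sum_congr rfl
    intro k _
    rw [Finset.sum_range, Finset.sum_filter]
    apply Finset.sum_congr rfl
    intro j _
    split_ifs with hj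
    · congr 2
      funext i
      have hi := i.isLt
      by_cases h : (i : ℕ) < 2 * k
      · have : ¬ (i : ℕ) = j := by omega
        simp [h, this]
      · have : min ((i : ℕ) + 2) (2 * n + 2) = i + 2 := by omega
        simp [h, this]
    · rfl

/-- The list version of a cochain. -/
def lst (n : ℕ) (f : (Fin (2 * n + 1) → L) → M) (l : List (L × L)) (z : L) : M :=
  if l.length = n then f (fun i => flat l z i) else 0

theorem flat_last (l : List (L × L)) (z : L) : ∀ i, flat l z i
    = if i < 2 * l.length then flat l 0 i else z := by
  induction l with
  | nil => intro i; simp [flat]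
  | cons c l ih =>
    intro i
    match i with
    | 0 => simp [flat, cns]
    | 1 =>
      have : 1 < 2 * (l.length + 1) := by omega
      simp [flat, cns, this]
    | i + 2 =>
      have : i + 2 < 2 * (l.length + 1) ↔ i < 2 * l.length := by omega
      simp only [flat, cns, List.length_cons, this]
      exact ih i

theorem flat_fst (l₁ l₂ : List (L × L)) (u y z : L) : ∀ i, flat (l₁ ++ (u, y) :: l₂) z i
    = if i = 2 * l₁.length then u else flat (l₁ ++ (0, y) :: l₂) z i := by
  induction l₁ with
  | nil =>
    intro i
    match i with
    | 0 => simp [flat, cns]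
    | 1 => simp [flat, cns]
    | i + 2 => simp [flat, cns]
  | cons c l ih =>
    intro i
    match i with
    | 0 => simp [flat, cns]
    | 1 =>
      have : ¬ 1 = 2 * (l.length + 1) := by omega
      simp [flat, cns, this]
    | i + 2 =>
      have : i + 2 = 2 * (l.length + 1) ↔ i = 2 * l.length := by omega
      simp only [List.cons_append, flat, cns, List.length_cons, this]
      exact ih i

theorem flat_snd (l₁ l₂ : List (L × L)) (u y z : L) : ∀ i, flat (l₁ ++ (y, u) :: l₂) z i
    = if i = 2 * l₁.length + 1 then u else flat (l₁ ++ (y, 0) :: l₂) z i := by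
  induction l₁ with
  | nil =>
    intro i
    match i with
    | 0 => simp [flat, cns]
    | 1 => simp [flat, cns]
    | i + 2 => simp [flat, cns]
  | cons c l ih =>
    intro i
    match i with
    | 0 => simp [flat, cns]
    | 1 =>
      have : ¬ 1 = 2 * (l.length + 1) + 1 := by omega
      simp [flat, cns, this]
    | i + 2 =>
      have : i + 2 = 2 * (l.length + 1) + 1 ↔ i = 2 * l.length + 1 := by omega
      simp only [List.cons_append, flat, cns, List.length_cons, this]
      exact ih i

theorem additive_lst (n : ℕ) (f : (Fin (2 * n + 1) → L) → M)
    (h : ∀ (x : Fin (2 * n + 1) → L) (i : Fin (2 * n + 1)) (u v : L),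
      f (Function.update x i (u + v)) = f (Function.update x i u) + f (Function.update x i v)) :
    Additive3 (lst n f) where
  last l u v := by
    unfold lst
    split_ifs with hl
    · have key : ∀ u : L, (fun i : Fin (2 * n + 1) => flat l u i)
          = Function.update (fun i : Fin (2 * n + 1) => flat l 0 i) ⟨2 * n, by omega⟩ u := by
        intro u
        funext i
        have hi := i.isLt
        rw [flat_last, Function.update_apply]
        have : i = ⟨2 * n, by omega⟩ ↔ ¬ (i : ℕ) < 2 * l.length := by
          rw [Fin.ext_iff]; simp only; omega
        simp only [this, ite_not]
      rw [key, h, ← key, ← key]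
    · simp
  fst l₁ l₂ u v y z := by
    unfold lst
    simp only [List.length_append, List.length_cons]
    split_ifs with hl
    · have key : ∀ u : L, (fun i : Fin (2 * n + 1) => flat (l₁ ++ (u, y) :: l₂) z i)
          = Function.update (fun i : Fin (2 * n + 1) => flat (l₁ ++ (0, y) :: l₂) z i)
            ⟨2 * l₁.length, by omega⟩ u := by
        intro u
        funext i
        rw [flat_fst, Function.update_apply]
        simp only [Fin.ext_iff]
      rw [key, h, ← key, ← key]
    · simp
  snd l₁ l₂ u v y z := by
    unfold lst
    simp only [List.length_append, List.length_cons]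
    split_ifs with hl
    · have key : ∀ u : L, (fun i : Fin (2 * n + 1) => flat (l₁ ++ (y, u) :: l₂) z i)
          = Function.update (fun i : Fin (2 * n + 1) => flat (l₁ ++ (y, 0) :: l₂) z i)
            ⟨2 * l₁.length + 1, by omega⟩ u := by
        intro u
        funext i
        rw [flat_snd, Function.update_apply]
        simp only [Fin.ext_iff]
      rw [key, h, ← key, ← key]
    · simp

theorem compat_lst (β : M →ₗ[R] M) (n : ℕ) (f : (Fin (2 * n + 1) → L) → M)
    (h : ∀ x : Fin (2 * n + 1) → L, f (fun i => α (x i)) = β (f x)) :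
    Compat α β (lst n f) (lst n f) := by
  intro l z
  unfold lst
  have : (lm α l).length = l.length := by simp [lm]
  rw [this]
  split_ifs with hl
  · rw [← h]
    congr 1
    funext i
    exact flat_lm α l z i
  · simp

theorem cochainDiff_flat (n : ℕ) (f : (Fin (2 * n + 1) → L) → M) (l : List (L × L)) (z : L)
    (hl : l.length = n + 1) :
    cochainDiff br α ψ n f (fun i => flat l z i) = dd br α ψ n (lst n f) (lst n f) l z := by
  rw [cochainDiff_eq_ex, ex_eq_dd _ _ _ _ _ _ _ _ _ hl]
  apply dd_congr <;>
  · intro l' z' h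
    have : l'.length = n := by omega
    simp [lst, this]

end Bridge

end HLR

/-- For a 3-Hom-Lie-Rinehart algebra `(L, α)` over `(A, φ)` with `φ`
an algebra automorphism and a left module `(M, β)` with action `ψ`, the coboundary map
`δ` satisfies `δ ∘ δ = 0`, so `(C^*(L; M), δ)` is a cochain complex. -/
theorem cochainDiff_cochainDiff_eq_zero
    {R A L M : Type*} [CommRing R] [CommRing A] [Algebra R A]
    [AddCommGroup L] [Module R L] [Module A L] [IsScalarTower R A L]
    [AddCommGroup M] [Module R M] [Module A M] [IsScalarTower R A M]
    (br : L →ₗ[R] L →ₗ[R] L →ₗ[R] L) (φ : A →ₐ[R] A) (α : L →ₗ[R] L)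
    (ρ : L →ₗ[R] L →ₗ[R] A →ₗ[R] A)
    (hLR : Is3HomLR φ br α ρ)
    (hφ : Function.Bijective φ)
    (β : M →ₗ[R] M) (ψ : L →ₗ[R] L →ₗ[R] M →ₗ[R] M)
    (hmod : IsLeftModule φ br α ρ β ψ)
    (n : ℕ) (f : (Fin (2 * n + 1) → L) → M)
    (hf : IsCochain φ α β n f) :
    ∀ x : Fin (2 * (n + 1) + 3) → L,
      cochainDiff br α ψ (n + 1) (cochainDiff br α ψ n f) x = 0 := by
  intro x
  obtain ⟨l, z, hl, hx⟩ := HLR.exists_flat (n + 2) x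
  have hx' : x = fun i : Fin (2 * (n + 1) + 3) => HLR.flat l z i := funext hx
  have e := HLR.cochainDiff_flat br α ψ (n + 1) (cochainDiff br α ψ n f) l z hl
  rw [hx']
  refine e.trans ?_
  rw [← HLR.dd_dd hLR.toIs3HomLie hLR.alpha_br hmod.rep n l (HLR.lst n f) (HLR.lst n f)
    (HLR.lst n f) z (by omega) (HLR.compat_lst α β n f hf.2.2.2.1)
    (HLR.compat_lst α β n f hf.2.2.2.1) (HLR.additive_lst n f hf.1)]
  apply HLR.dd_congr <;>
  · intro l' z' h
    have h' : l'.length = n + 1 := by omega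
    rw [← HLR.cochainDiff_flat br α ψ n f l' z' h', HLR.lst, if_pos h']
    rfl
end

section
/- Let 0 → (M, β) →ᵢ (L', α') →σ (L, α) → 0 be an A-split abelian extension of a 3-Hom-Lie-Rinehart algebra (L, α) over (A, φ) by (M, β), and let τ : L → L' be an A-module section (σ ∘ τ = id_L, τ(a·x) = a·τ(x), τ ∘ α = α' ∘ τ). Then ψ : L×L → End_R(M) defined by i(ψ(x₁, x₂)(m)) := [τ(x₁), τ(x₂), i(m)]' makes (M, β) a left module over (L, α); moreover ψ does not depend on the choice of A-module section τ, and equivalent A-split abelian extensions induce the same module structure on (M, β). -/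
section Extension

/-- A one-cocycle condition for a trilinear map `ω : L×L×L → M` with respect to the
module action `ψ` of a 3-Hom-Lie-Rinehart algebra `(L, br, α)`. -/
def IsCocycleIdentity {R L M : Type*} [CommRing R]
    [AddCommGroup L] [Module R L] [AddCommGroup M] [Module R M]
    (br : L →ₗ[R] L →ₗ[R] L →ₗ[R] L) (α : L →ₗ[R] L)
    (ψ : L →ₗ[R] L →ₗ[R] M →ₗ[R] M) (ω : L → L → L → M) : Prop :=
  ∀ x y z u v : L,
    ω (br x u v) (α y) (α z) + ω (br y u v) (α z) (α x) + ω (α x) (α y) (br z u v)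
      - ω (br x y z) (α u) (α v)
      + ψ (α y) (α z) (ω x u v) + ψ (α z) (α x) (ω y u v)
      + ψ (α x) (α y) (ω z u v) - ψ (α u) (α v) (ω x y z) = 0

/-- `0 → (M, β) →ᵢ (L', α') →σ (L, α) → 0` is an `A`-split abelian extension of the
3-Hom-Lie-Rinehart algebra `(L, br, α, ρ)` by the module `(M, β)`. -/
structure IsASplitAbelianExt
    {R A L L' M : Type*} [CommRing R] [CommRing A] [Algebra R A]
    [AddCommGroup L] [Module R L] [Module A L] [IsScalarTower R A L]
    [AddCommGroup L'] [Module R L'] [Module A L'] [IsScalarTower R A L']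
    [AddCommGroup M] [Module R M] [Module A M] [IsScalarTower R A M]
    (φ : A →ₐ[R] A)
    (br : L →ₗ[R] L →ₗ[R] L →ₗ[R] L) (α : L →ₗ[R] L) (ρ : L →ₗ[R] L →ₗ[R] A →ₗ[R] A)
    (br' : L' →ₗ[R] L' →ₗ[R] L' →ₗ[R] L') (α' : L' →ₗ[R] L')
    (ρ' : L' →ₗ[R] L' →ₗ[R] A →ₗ[R] A)
    (β : M →ₗ[R] M)
    (i : M →ₗ[A] L') (σ : L' →ₗ[A] L) : Prop where
  base : Is3HomLR φ br α ρ
  total : Is3HomLR φ br' α' ρ'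
  inj : Function.Injective i
  surj : Function.Surjective σ
  exact : ∀ p : L', σ p = 0 ↔ ∃ m : M, i m = p
  i_beta : ∀ m, i (β m) = α' (i m)
  sigma_alpha : ∀ p, σ (α' p) = α (σ p)
  sigma_br : ∀ p q r, σ (br' p q r) = br (σ p) (σ q) (σ r)
  rho_comp : ∀ p q, ρ' p q = ρ (σ p) (σ q)
  abelian₁ : ∀ (p : L') (m n : M), br' p (i m) (i n) = 0
  abelian₂ : ∀ (p : L') (m n : M), br' (i m) p (i n) = 0
  abelian₃ : ∀ (p : L') (m n : M), br' (i m) (i n) p = 0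
  split : ∃ τ : L →ₗ[A] L', (∀ x, σ (τ x) = x) ∧ (∀ x, τ (α x) = α' (τ x))

end Extension

/-- The bracket with an element of `i(M)` only depends on the projections to `L`. -/
theorem ext_br_congr
    {R A L L' M : Type*} [CommRing R] [CommRing A] [Algebra R A]
    [AddCommGroup L] [Module R L] [Module A L] [IsScalarTower R A L]
    [AddCommGroup L'] [Module R L'] [Module A L'] [IsScalarTower R A L']
    [AddCommGroup M] [Module R M] [Module A M] [IsScalarTower R A M]
    {br : L →ₗ[R] L →ₗ[R] L →ₗ[R] L} {φ : A →ₐ[R] A} {α : L →ₗ[R] L}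
    {ρ : L →ₗ[R] L →ₗ[R] A →ₗ[R] A}
    {br' : L' →ₗ[R] L' →ₗ[R] L' →ₗ[R] L'} {α' : L' →ₗ[R] L'}
    {ρ' : L' →ₗ[R] L' →ₗ[R] A →ₗ[R] A}
    {β : M →ₗ[R] M} {i : M →ₗ[A] L'} {σ : L' →ₗ[A] L}
    (ext : IsASplitAbelianExt φ br α ρ br' α' ρ' β i σ)
    {p p' q q' : L'} (hp : σ p = σ p') (hq : σ q = σ q') (m : M) :
    br' p q (i m) = br' p' q' (i m) := by
  obtain ⟨n, hn⟩ := (ext.exact (p - p')).1 (by rw [map_sub, hp, sub_self])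
  obtain ⟨k, hk⟩ := (ext.exact (q - q')).1 (by rw [map_sub, hq, sub_self])
  have hp2 : p = p' + i n := by rw [hn]; abel
  have hq2 : q = q' + i k := by rw [hk]; abel
  subst hp2 hq2
  simp only [map_add, LinearMap.add_apply, ext.abelian₁, ext.abelian₂, add_zero]


/-- Given an `A`-split abelian extension
`0 → (M, β) →ᵢ (L', α') →σ (L, α) → 0` with `A`-module section `τ`, the map
`ψ` defined by `i(ψ(x₁, x₂)(m)) = [τ(x₁), τ(x₂), i(m)]'` makes `(M, β)` a left module
over `(L, α)`; this module structure does not depend on the choice of the section,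
and equivalent `A`-split abelian extensions induce the same module structure. -/
theorem induced_module_structure_of_extension
    {R A L L' M : Type*} [CommRing R] [CommRing A] [Algebra R A]
    [AddCommGroup L] [Module R L] [Module A L] [IsScalarTower R A L]
    [AddCommGroup L'] [Module R L'] [Module A L'] [IsScalarTower R A L']
    [AddCommGroup M] [Module R M] [Module A M] [IsScalarTower R A M]
    (br : L →ₗ[R] L →ₗ[R] L →ₗ[R] L) (φ : A →ₐ[R] A) (α : L →ₗ[R] L)
    (ρ : L →ₗ[R] L →ₗ[R] A →ₗ[R] A)
    (br' : L' →ₗ[R] L' →ₗ[R] L' →ₗ[R] L') (α' : L' →ₗ[R] L')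
    (ρ' : L' →ₗ[R] L' →ₗ[R] A →ₗ[R] A)
    (β : M →ₗ[R] M) (i : M →ₗ[A] L') (σ : L' →ₗ[A] L)
    (ext : IsASplitAbelianExt φ br α ρ br' α' ρ' β i σ)
    (τ : L →ₗ[A] L')
    (hτσ : ∀ x, σ (τ x) = x) (hτα : ∀ x, τ (α x) = α' (τ x))
    (ψ : L →ₗ[R] L →ₗ[R] M →ₗ[R] M)
    (hψ : ∀ (x₁ x₂ : L) (m : M), i (ψ x₁ x₂ m) = br' (τ x₁) (τ x₂) (i m)) :
    -- (1) `(M, β)` with action `ψ` is a left module over `(L, α)`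
    IsLeftModule φ br α ρ β ψ ∧
    -- (2) `ψ` is independent of the choice of the `A`-module section
    (∀ (τ₂ : L →ₗ[A] L'), (∀ x, σ (τ₂ x) = x) → (∀ x, τ₂ (α x) = α' (τ₂ x)) →
      ∀ (ψ₂ : L →ₗ[R] L →ₗ[R] M →ₗ[R] M),
        (∀ (x₁ x₂ : L) (m : M), i (ψ₂ x₁ x₂ m) = br' (τ₂ x₁) (τ₂ x₂) (i m)) →
        ψ₂ = ψ) ∧
    -- (3) equivalent `A`-split abelian extensions induce the same module structure
    (∀ (L'' : Type _) (_ : AddCommGroup L'') (_ : Module R L'') (_ : Module A L'')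
        (_ : IsScalarTower R A L'')
        (br'' : L'' →ₗ[R] L'' →ₗ[R] L'' →ₗ[R] L'') (α'' : L'' →ₗ[R] L'')
        (ρ'' : L'' →ₗ[R] L'' →ₗ[R] A →ₗ[R] A)
        (i' : M →ₗ[A] L'') (σ' : L'' →ₗ[A] L),
      IsASplitAbelianExt φ br α ρ br'' α'' ρ'' β i' σ' →
      ∀ (Φ : L' →ₗ[A] L''), Function.Bijective Φ →
        (∀ p q r, Φ (br' p q r) = br'' (Φ p) (Φ q) (Φ r)) →
        (∀ p, Φ (α' p) = α'' (Φ p)) →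
        (∀ p q, ρ'' (Φ p) (Φ q) = ρ' p q) →
        (∀ m, Φ (i m) = i' m) → (∀ p, σ' (Φ p) = σ p) →
      ∀ (τ₂ : L →ₗ[A] L''), (∀ x, σ' (τ₂ x) = x) → (∀ x, τ₂ (α x) = α'' (τ₂ x)) →
      ∀ (ψ₂ : L →ₗ[R] L →ₗ[R] M →ₗ[R] M),
        (∀ (x₁ x₂ : L) (m : M), i' (ψ₂ x₁ x₂ m) = br'' (τ₂ x₁) (τ₂ x₂) (i' m)) →
        ψ₂ = ψ) := by
  have sk12 := ext.total.toIs3HomLie.skew₁₂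
  have sk23 := ext.total.toIs3HomLie.skew₂₃
  have cyc : ∀ x y z, br' x y z = br' y z x := fun x y z => by
    rw [sk12 x y z, sk23 y x z, neg_neg]
  have σi : ∀ m, σ (i m) = 0 := fun m => (ext.exact _).2 ⟨m, rfl⟩
  have hbr : ∀ x y z, σ (τ (br x y z)) = σ (br' (τ x) (τ y) (τ z)) := fun x y z => by
    rw [ext.sigma_br, hτσ, hτσ, hτσ, hτσ]
  have smul1 : ∀ (a : A) (x y : L) (m : M),
      br' (a • τ x) (τ y) (i m) = φ (φ a) • br' (τ x) (τ y) (i m) := fun a x y m => by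
    rw [cyc, ext.total.br_smul, ext.rho_comp, σi, map_zero, LinearMap.zero_apply, zero_smul,
      add_zero, ← cyc]
  have smul2 : ∀ (a : A) (x y : L) (m : M),
      br' (τ x) (a • τ y) (i m) = φ (φ a) • br' (τ x) (τ y) (i m) := fun a x y m => by
    rw [sk12, smul1, sk12 (τ x), smul_neg]
  refine ⟨⟨⟨?_, ?_, ?_, ?_⟩, ?_, ?_, ?_, ?_⟩, ?_, ?_⟩
  · intro x y
    ext m
    apply ext.inj
    rw [LinearMap.neg_apply, map_neg, hψ, hψ, sk12]
  · intro x y m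
    apply ext.inj
    rw [hψ, ext.i_beta, ext.i_beta, hψ, hτα, hτα, ext.total.alpha_br]
  · intro x₁ x₂ x₃ x₄ m
    apply ext.inj
    simp only [map_sub, hψ]
    rw [ext_br_congr ext (hbr x₁ x₂ x₃) rfl, ext_br_congr ext rfl (hbr x₁ x₂ x₄)]
    simp only [hτα, ext.i_beta]
    rw [ext.total.toIs3HomLie.jacobi (τ x₁) (τ x₂) (τ x₃) (τ x₄) (i m)]
    abel
  · intro x₁ x₂ x₃ x₄ m
    apply ext.inj
    simp only [map_add, hψ]
    rw [ext_br_congr ext (hbr x₁ x₂ x₃) rfl]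
    simp only [hτα, ext.i_beta]
    rw [cyc, ext.total.toIs3HomLie.jacobi (τ x₄) (i m) (τ x₁) (τ x₂) (τ x₃),
      ← cyc (τ x₁) (τ x₄) (i m), ← cyc (τ x₂) (τ x₄) (i m), ← cyc (τ x₃) (τ x₄) (i m),
      cyc (br' (τ x₁) (τ x₄) (i m)), ← cyc (α' (τ x₃)) (α' (τ x₁))]
    abel
  · intro a m
    apply ext.inj
    rw [ext.i_beta, map_smul i, map_smul i, ext.total.alpha_smul, ext.i_beta]
  · intro a x y
    ext m
    apply ext.inj
    rw [hψ, hψ, map_smul τ, map_smul τ, smul1, smul2]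
  · intro a x y m
    apply ext.inj
    rw [hψ, map_smul τ, map_smul i, smul1, hψ]
  · intro x y a m
    apply ext.inj
    rw [hψ, map_smul i, ext.total.br_smul, map_add, map_smul i, map_smul i, hψ, ext.rho_comp,
      hτσ, hτσ, ext.i_beta, ext.i_beta]
  · intro τ₂ h₂ _ ψ₂ hψ₂
    ext x y m
    apply ext.inj
    rw [hψ, hψ₂]
    exact ext_br_congr ext (by rw [h₂, hτσ]) (by rw [h₂, hτσ]) m
  · intro L'' _ _ _ _ br'' α'' ρ'' i' σ' ext' Φ _ hΦ _ _ hi hσ τ₂ h₂ _ ψ₂ hψ₂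
    ext x y m
    apply ext'.inj
    rw [hψ₂, ← hi (ψ x y m), hψ, hΦ, hi]
    exact ext_br_congr ext' (by rw [h₂, hσ, hτσ]) (by rw [h₂, hσ, hτσ]) m
end

section
/- Let 0 → (M, β) →ᵢ (L', α') →σ (L, α) → 0 be an A-split abelian extension of a 3-Hom-Lie-Rinehart algebra (L, α) over (A, φ) by (M, β), with A-module section τ, and let ψ be the induced module action on M. Define Ω_τ(x, y, z) := i⁻¹([τ(x), τ(y), τ(z)]' − τ([x, y, z])) for x, y, z ∈ L (well-defined since [τ(x), τ(y), τ(z)]' − τ([x, y, z]) ∈ ker σ = i(M)). Then Ω_τ is a 1-cocycle in C¹(L; M): it is skew-symmetric trilinear, Ω_τ(a·x, y, z) = φ²(a)·Ω_τ(x, y, z) for a ∈ A, Ω_τ ∘ (α × α × α) = β ∘ Ω_τ, and δ(Ω_τ) = 0. -/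
/-- For an `A`-split abelian extension with section `τ` and induced
module action `ψ`, the map `Ω_τ(x,y,z) = i⁻¹([τ x, τ y, τ z]' − τ [x,y,z])` is a
1-cocycle in `C¹(L; M)`: it is skew-symmetric and trilinear, satisfies
`Ω_τ(a·x, y, z) = φ²(a)·Ω_τ(x,y,z)`, `Ω_τ ∘ (α × α × α) = β ∘ Ω_τ`, and `δ Ω_τ = 0`. -/
theorem extension_cocycle_is_one_cocycle
    {R A L L' M : Type*} [CommRing R] [CommRing A] [Algebra R A]
    [AddCommGroup L] [Module R L] [Module A L] [IsScalarTower R A L]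
    [AddCommGroup L'] [Module R L'] [Module A L'] [IsScalarTower R A L']
    [AddCommGroup M] [Module R M] [Module A M] [IsScalarTower R A M]
    (br : L →ₗ[R] L →ₗ[R] L →ₗ[R] L) (φ : A →ₐ[R] A) (α : L →ₗ[R] L)
    (ρ : L →ₗ[R] L →ₗ[R] A →ₗ[R] A)
    (br' : L' →ₗ[R] L' →ₗ[R] L' →ₗ[R] L') (α' : L' →ₗ[R] L')
    (ρ' : L' →ₗ[R] L' →ₗ[R] A →ₗ[R] A)
    (β : M →ₗ[R] M) (i : M →ₗ[A] L') (σ : L' →ₗ[A] L)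
    (ext : IsASplitAbelianExt φ br α ρ br' α' ρ' β i σ)
    (τ : L →ₗ[A] L')
    (hτσ : ∀ x, σ (τ x) = x) (hτα : ∀ x, τ (α x) = α' (τ x))
    (ψ : L →ₗ[R] L →ₗ[R] M →ₗ[R] M)
    (hψ : ∀ (x₁ x₂ : L) (m : M), i (ψ x₁ x₂ m) = br' (τ x₁) (τ x₂) (i m))
    (Ω : L → L → L → M)
    (hΩ : ∀ x y z, i (Ω x y z) = br' (τ x) (τ y) (τ z) - τ (br x y z)) :
    -- trilinearity
    (∀ x x' y z, Ω (x + x') y z = Ω x y z + Ω x' y z) ∧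
    (∀ x y y' z, Ω x (y + y') z = Ω x y z + Ω x y' z) ∧
    (∀ x y z z', Ω x y (z + z') = Ω x y z + Ω x y z') ∧
    (∀ (r : R) (x y z : L), Ω (r • x) y z = r • Ω x y z) ∧
    (∀ (r : R) (x y z : L), Ω x (r • y) z = r • Ω x y z) ∧
    (∀ (r : R) (x y z : L), Ω x y (r • z) = r • Ω x y z) ∧
    -- skew-symmetry
    (∀ x y z, Ω x y z = - Ω y x z) ∧
    (∀ x y z, Ω x y z = - Ω x z y) ∧
    -- A-function-linearity
    (∀ (a : A) (x y z : L), Ω (a • x) y z = φ (φ a) • Ω x y z) ∧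
    -- compatibility with (α, β)
    (∀ x y z, Ω (α x) (α y) (α z) = β (Ω x y z)) ∧
    -- the cocycle identity δ Ω = 0
    IsCocycleIdentity br α ψ Ω := by
  have h12 := ext.base.toIs3HomLie.skew₁₂
  have h23 := ext.base.toIs3HomLie.skew₂₃
  have k12 := ext.total.toIs3HomLie.skew₁₂
  have k23 := ext.total.toIs3HomLie.skew₂₃
  have hcyc : ∀ x y z, br x y z = br y z x := fun x y z => by
    rw [h12 x y z, h23 y x z, neg_neg]
  have kcyc : ∀ x y z, br' x y z = br' y z x := fun x y z => by
    rw [k12 x y z, k23 y x z, neg_neg]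
  have τR : ∀ (r : R) (x : L), τ (r • x) = r • τ x := fun r x => by
    rw [← algebraMap_smul A r x, map_smul, algebraMap_smul]
  have iR : ∀ (r : R) (x : M), i (r • x) = r • i x := fun r x => by
    rw [← algebraMap_smul A r x, map_smul, algebraMap_smul]
  refine ⟨?_, ?_, ?_, ?_, ?_, ?_, ?_, ?_, ?_, ?_, ?_⟩
  · intro x x' y z
    apply ext.inj
    simp only [hΩ, map_add, LinearMap.add_apply]
    abel
  · intro x x' y z
    apply ext.inj
    simp only [hΩ, map_add, LinearMap.add_apply]
    abel
  · intro x x' y z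
    apply ext.inj
    simp only [hΩ, map_add, LinearMap.add_apply]
    abel
  · intro r x y z
    apply ext.inj
    rw [iR]
    simp only [hΩ, τR, LinearMap.map_smul br, LinearMap.map_smul br', LinearMap.smul_apply, smul_sub]
  · intro r x y z
    apply ext.inj
    rw [iR]
    simp only [hΩ, τR, LinearMap.map_smul (br _), LinearMap.map_smul (br' _),
      LinearMap.smul_apply, smul_sub]
  · intro r x y z
    apply ext.inj
    rw [iR]
    simp only [hΩ, τR, LinearMap.map_smul (br _ _), LinearMap.map_smul (br' _ _), smul_sub]
  · intro x y z
    apply ext.inj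
    rw [map_neg, hΩ, hΩ, k12, h12, map_neg]
    abel
  · intro x y z
    apply ext.inj
    rw [map_neg, hΩ, hΩ, k23, h23, map_neg]
    abel
  · intro a x y z
    apply ext.inj
    rw [map_smul, hΩ, hΩ, hcyc, kcyc, map_smul, ext.base.br_smul, ext.total.br_smul,
      ext.rho_comp, hτσ, hτσ, map_add, map_smul, map_smul, hτα, hτα, hcyc x, kcyc (τ x), smul_sub]
    abel
  · intro x y z
    apply ext.inj
    rw [ext.i_beta, hΩ, hΩ, map_sub, ext.total.alpha_br, ← hτα, ← hτα, ← hτα, ← hτα,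
      ext.base.alpha_br]
  · intro x y z u v
    apply ext.inj
    have J := congrArg τ (ext.base.toIs3HomLie.jacobi u v x y z)
    have J' := ext.total.toIs3HomLie.jacobi (τ u) (τ v) (τ x) (τ y) (τ z)
    have b1 : br (α x) (br u v y) (α z) = br (br u v y) (α z) (α x) := hcyc _ _ _
    have c1 : br' (α' (τ x)) (br' (τ u) (τ v) (τ y)) (α' (τ z))
      = br' (α' (τ z)) (α' (τ x)) (br' (τ u) (τ v) (τ y)) := by rw [kcyc, kcyc]
    have b2 : br (br x y z) (α u) (α v) = br (α u) (α v) (br x y z) := hcyc _ _ _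
    rw [b1, map_add, map_add] at J
    rw [c1, kcyc (br' (τ u) (τ v) (τ x))] at J'
    simp only [map_add, map_sub, hψ, hΩ, hτα, map_zero]
    rw [b2, hcyc x u v, hcyc y u v, hcyc z u v, kcyc (τ x) (τ u) (τ v),
      kcyc (τ y) (τ u) (τ v), kcyc (τ z) (τ u) (τ v), J, J',
      kcyc (τ (br u v x)), kcyc (τ (br u v y)), kcyc (τ (br x y z))]
    abel
end
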